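/- arXiv:2211.07694 — 2 statements merged into one kernel-verified Lean document; each statement's English description precedes it below -/
import Mathlib

section
/- Let X_0, X_1, ..., X_d be bounded real intervals, let μ_i be a Borel probability measure on X_i for each i = 0, ..., d, and let s ∈ C²(X_0 × ... × X_d) be weakly compatible. Then the s-comonotone coupling π = (G_0, G_1, ..., G_d)_# Leb_{[0,1]} is a maximizer of ∫ s dπ over all π ∈ Γ(μ_0, μ_1, ..., μ_d). -/
open MeasureTheory Set
open scoped Classical

/-- Quantile (generalized inverse c.d.f.) of a probability measure on ℝ. -/
noncomputable def quantile (μ : Measure ℝ) (m : ℝ) : ℝ :=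
  sInf {x : ℝ | ENNReal.ofReal m ≤ μ (Iic x)}

/-- Lebesgue measure restricted to `[0,1]`. -/
noncomputable def lebI : Measure ℝ := volume.restrict (Icc (0:ℝ) 1)

/-- Mixed second partial derivative `∂²s/∂x_i∂x_j`. -/
noncomputable def partial2 {n : ℕ} (s : (Fin n → ℝ) → ℝ) (i j : Fin n)
    (x : Fin n → ℝ) : ℝ :=
  fderiv ℝ (fun y => fderiv ℝ s y (Pi.single i 1)) x (Pi.single j 1)

open Filter Topology

structure GoodPot {n : ℕ} (r : Fin n → ℝ → ℝ → Prop) (I : Fin n → Set ℝ)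
    (f : (Fin n → ℝ) → ℝ) (C : Set (Fin n → ℝ)) (M : Fin n → ℝ) (u : Fin n → ℝ → ℝ) : Prop where
  mem : M ∈ C
  box : ∀ p ∈ C, ∀ i, p i ∈ I i
  le : ∀ p ∈ C, ∀ i, r i (p i) (M i)
  eq : ∀ p ∈ C, f p = ∑ i, u i (p i)
  bd : ∀ x : Fin n → ℝ, (∀ i, ∃ p ∈ C, p i = x i) → f x ≤ ∑ i, u i (x i)

def IncrDiff {n : ℕ} (r : Fin n → ℝ → ℝ → Prop) (I : Fin n → Set ℝ)
    (f : (Fin n → ℝ) → ℝ) : Prop :=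
  ∀ (i : Fin n) (y z : Fin n → ℝ) (β : ℝ), (∀ j, y j ∈ I j) → (∀ j, z j ∈ I j) → β ∈ I i →
    (∀ j, r j (y j) (z j)) → y i = z i → r i (y i) β →
    f (Function.update y i β) - f y ≤ f (Function.update z i β) - f z

lemma GoodPot.step {n : ℕ} {r : Fin n → ℝ → ℝ → Prop} {I : Fin n → Set ℝ}
    {f : (Fin n → ℝ) → ℝ} (hrefl : ∀ i x, r i x x)
    (htrans : ∀ i x y z, r i x y → r i y z → r i x z)
    (hanti : ∀ i x y, r i x y → r i y x → x = y)
    (hf : IncrDiff r I f) {C : Set (Fin n → ℝ)} {M : Fin n → ℝ} {u : Fin n → ℝ → ℝ}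
    (h : GoodPot r I f C M u) (i : Fin n) (β : ℝ) (hβ : β ∈ I i) (hM : r i (M i) β) :
    ∃ C' u', C ⊆ C' ∧ GoodPot r I f C' (Function.update M i β) u' := by
  by_cases hβM : β = M i
  · refine ⟨C, u, subset_rfl, ?_⟩
    rw [hβM, Function.update_eq_self]
    exact h
  set q := Function.update M i β with hq
  have hqi : q i = β := by simp [hq]
  have hqj : ∀ j, j ≠ i → q j = M j := fun j hj => by simp [hq, hj]
  set u' : Fin n → ℝ → ℝ :=
    Function.update u i (Function.update (u i) β (u i (M i) + (f q - f M))) with hu'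
  have hne : ∀ w : Fin n → ℝ, w i ≠ β → ∑ j, u' j (w j) = ∑ j, u j (w j) := by
    intro w hw
    refine Finset.sum_congr rfl fun j _ => ?_
    by_cases hj : j = i
    · subst hj; simp [hu', hw]
    · simp [hu', hj]
  have heq : ∀ w : Fin n → ℝ, w i = β →
      ∑ j, u' j (w j) = ∑ j, u j (Function.update w i (M i) j) + (f q - f M) := by
    intro w hw
    have : ∀ j, u' j (w j) = u j (Function.update w i (M i) j) +
        if j = i then (f q - f M) else 0 := by
      intro j
      by_cases hj : j = i
      · subst hj; simp [hu', hw]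
      · simp [hu', hj]
    simp only [this, Finset.sum_add_distrib, Finset.sum_ite_eq', Finset.mem_univ, if_true]
  have hCβ : ∀ p ∈ C, p i ≠ β := by
    intro p hp hpb
    exact hβM (hanti i _ _ (hpb ▸ h.le p hp i) hM)
  refine ⟨insert q C, u', subset_insert _ _, ?_, ?_, ?_, ?_, ?_⟩
  · exact mem_insert _ _
  · rintro p (rfl | hp) j
    · by_cases hj : j = i
      · subst hj; rw [hqi]; exact hβ
      · rw [hqj j hj]; exact h.box M h.mem j
    · exact h.box p hp j
  · rintro p (rfl | hp) j
    · exact hrefl _ _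
    · by_cases hj : j = i
      · subst hj; rw [hqi]; exact htrans _ _ _ _ (h.le p hp j) hM
      · rw [hqj j hj]; exact h.le p hp j
  · rintro p (rfl | hp)
    · rw [heq q hqi]
      have : Function.update q i (M i) = M := by simp [hq]
      rw [this, ← h.eq M h.mem]; ring
    · rw [hne p (hCβ p hp)]; exact h.eq p hp
  · intro x hx
    have hx' : ∀ j, j ≠ i → ∃ p ∈ C, p j = x j := by
      intro j hj
      obtain ⟨p, hp | hp, hpx⟩ := hx j
      · exact ⟨M, h.mem, by rw [← hpx, hp, hqj j hj]⟩
      · exact ⟨p, hp, hpx⟩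
    by_cases hxi : x i = β
    · rw [heq x hxi]
      set y := Function.update x i (M i) with hy
      have hyC : ∀ j, ∃ p ∈ C, p j = y j := by
        intro j
        by_cases hj : j = i
        · subst hj; exact ⟨M, h.mem, by simp [hy]⟩
        · simpa [hy, hj] using hx' j hj
      have h1 := h.bd y hyC
      have hyI : ∀ j, y j ∈ I j := by
        intro j
        obtain ⟨p, hp, hpy⟩ := hyC j
        rw [← hpy]; exact h.box p hp j
      have hyM : ∀ j, r j (y j) (M j) := by
        intro j
        obtain ⟨p, hp, hpy⟩ := hyC j
        rw [← hpy]; exact h.le p hp j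
      have h2 := hf i y M β hyI (h.box M h.mem) hβ hyM (by simp [hy]) (by simpa [hy] using hM)
      have h3 : Function.update y i β = x := by
        rw [hy, Function.update_idem, ← hxi, Function.update_eq_self]
      rw [h3] at h2
      linarith
    · rw [hne x hxi]
      apply h.bd
      intro j
      by_cases hj : j = i
      · subst hj
        obtain ⟨p, hp | hp, hpx⟩ := hx j
        · exact absurd (by rw [← hpx, hp, hqi]) hxi
        · exact ⟨p, hp, hpx⟩
      · exact hx' j hj

lemma GoodPot.path {n : ℕ} {r : Fin n → ℝ → ℝ → Prop} {I : Fin n → Set ℝ}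
    {f : (Fin n → ℝ) → ℝ} (hrefl : ∀ i x, r i x x)
    (htrans : ∀ i x y z, r i x y → r i y z → r i x z)
    (hanti : ∀ i x y, r i x y → r i y x → x = y)
    (hf : IncrDiff r I f) {C : Set (Fin n → ℝ)} {M : Fin n → ℝ} {u : Fin n → ℝ → ℝ}
    (h : GoodPot r I f C M u) (q : Fin n → ℝ) (hq : ∀ i, q i ∈ I i)
    (hM : ∀ i, r i (M i) (q i)) :
    ∃ C' u', C ⊆ C' ∧ GoodPot r I f C' q u' := by
  have key : ∀ S : Finset (Fin n), ∃ C' u', C ⊆ C' ∧ GoodPot r I f C' (S.piecewise q M) u' := by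
    intro S
    induction S using Finset.induction_on with
    | empty => exact ⟨C, u, subset_rfl, by simpa using h⟩
    | insert j S hj ih =>
      obtain ⟨C', u', hC, hg⟩ := ih
      have := hg.step hrefl htrans hanti hf j (q j) (hq j) (by simpa [hj] using hM j)
      obtain ⟨C'', u'', hC', hg'⟩ := this
      refine ⟨C'', u'', hC.trans hC', ?_⟩
      rw [Finset.piecewise_insert]
      exact hg'
  simpa using key Finset.univ

lemma exists_pot {d : ℕ} {r : Fin (d+1) → ℝ → ℝ → Prop} {I : Fin (d+1) → Set ℝ}
    {f : (Fin (d+1) → ℝ) → ℝ} (hrefl : ∀ i x, r i x x)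
    (htrans : ∀ i x y z, r i x y → r i y z → r i x z)
    (hanti : ∀ i x y, r i x y → r i y x → x = y)
    (hf : IncrDiff r I f) (b : Fin (d+1) → ℝ) (hb : ∀ i, b i ∈ I i)
    (hbI : ∀ i, ∀ x ∈ I i, r i (b i) x)
    (J : Set ℝ) (P : ℝ → Fin (d+1) → ℝ) (hPI : ∀ m ∈ J, ∀ i, P m i ∈ I i)
    (hmono : ∀ m ∈ J, ∀ m' ∈ J, m ≤ m' → ∀ i, r i (P m i) (P m' i))
    (hfin : (P '' J).Finite) :
    ∃ u : Fin (d+1) → ℝ → ℝ, (∀ m ∈ J, f (P m) = ∑ i, u i (P m i)) ∧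
      ∀ x : Fin (d+1) → ℝ, (∀ i, ∃ m ∈ J, P m i = x i) → f x ≤ ∑ i, u i (x i) := by
  have key : ∀ T : Finset ℝ, (∀ t ∈ T, t ∈ J) → ∃ C M u, GoodPot r I f C M u ∧
      (∀ t ∈ T, P t ∈ C) ∧ ∀ m ∈ J, (∀ t ∈ T, t ≤ m) → ∀ i, r i (M i) (P m i) := by
    intro T
    induction T using Finset.induction_on_max with
    | empty =>
      intro _
      have hn : ((d:ℝ)+1) ≠ 0 := by positivity
      refine ⟨{b}, b, fun _ _ => f b / (d+1), ⟨rfl, ?_, ?_, ?_, ?_⟩, by simp, ?_⟩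
      · rintro p rfl; exact hb
      · rintro p rfl i; exact hrefl _ _
      · rintro p rfl; simp; field_simp
      · intro x hx
        have : x = b := by
          funext i
          obtain ⟨p, rfl, hp⟩ := hx i
          exact hp.symm
        subst this
        simp; apply le_of_eq; field_simp
      · intro m hm _ i
        exact hbI i _ (hPI m hm i)
    | insert t T hT ih =>
      intro hJ
      obtain ⟨C, M, u, hg, hPC, hM⟩ := ih (fun s hs => hJ s (Finset.mem_insert_of_mem hs))
      have ht : t ∈ J := hJ t (Finset.mem_insert_self _ _)
      obtain ⟨C', u', hC, hg'⟩ := hg.path hrefl htrans hanti hf (P t) (hPI t ht)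
        (hM t ht fun s hs => (hT s hs).le)
      refine ⟨C', P t, u', hg', ?_, ?_⟩
      · intro s hs
        rcases Finset.mem_insert.1 hs with rfl | hs
        · exact hg'.mem
        · exact hC (hPC s hs)
      · intro m hm hle i
        exact hmono t ht m hm (hle t (Finset.mem_insert_self _ _)) i
  obtain ⟨T, hTJ, hT⟩ := SurjOn.exists_bijOn_subset (surjOn_image P J)
  have hTf : T.Finite := by
    apply Set.Finite.of_finite_image _ hT.injOn
    rw [hT.image_eq]; exact hfin
  obtain ⟨C, M, u, hg, hPC, -⟩ := key hTf.toFinset (fun t ht => hTJ (by simpa using ht))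
  have hC : ∀ m ∈ J, P m ∈ C := by
    intro m hm
    obtain ⟨t, ht, htm⟩ := hT.surjOn (mem_image_of_mem P hm)
    rw [← htm]; exact hPC t (by simpa using ht)
  refine ⟨u, fun m hm => hg.eq _ (hC m hm), fun x hx => hg.bd x fun i => ?_⟩
  obtain ⟨m, hm, h⟩ := hx i
  exact ⟨P m, hC m hm, h⟩

/-- the order on coordinate `i` -/
def ordRel {n : ℕ} (S : Set (Fin n)) (i : Fin n) (x y : ℝ) : Prop :=
  (i ∈ S → x ≤ y) ∧ (i ∉ S → y ≤ x)

lemma incrDiff_of {n : ℕ} (a c : Fin n → ℝ) (s : (Fin n → ℝ) → ℝ) (hs : ContDiff ℝ 2 s)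
    (S : Set (Fin n))
    (hsame : ∀ i j, i ≠ j → ((i ∈ S ∧ j ∈ S) ∨ (i ∉ S ∧ j ∉ S)) →
      ∀ x ∈ {x : Fin n → ℝ | ∀ i, x i ∈ Icc (a i) (c i)}, 0 ≤ partial2 s i j x)
    (hdiff : ∀ i j, i ≠ j → ¬((i ∈ S ∧ j ∈ S) ∨ (i ∉ S ∧ j ∉ S)) →
      ∀ x ∈ {x : Fin n → ℝ | ∀ i, x i ∈ Icc (a i) (c i)}, partial2 s i j x ≤ 0) :
    IncrDiff (ordRel S) (fun i => Icc (a i) (c i)) s := by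
  intro i y z β hy hz hβ hyz hi hiβ
  set K := {x : Fin n → ℝ | ∀ i, x i ∈ Icc (a i) (c i)} with hK
  have hKc : Convex ℝ K := by
    have : K = Set.pi univ (fun i => Icc (a i) (c i)) := by
      ext x
      exact ⟨fun h i _ => h i, fun h i => h i (mem_univ i)⟩
    rw [this]
    exact convex_pi fun i _ => convex_Icc _ _
  set φ : (Fin n → ℝ) → ℝ := fun y => fderiv ℝ s y (Pi.single i 1) with hφ
  have hφd : Differentiable ℝ φ := by
    have h1 : ContDiff ℝ 1 (fderiv ℝ s) := hs.fderiv_right (by norm_num)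
    have : ContDiff ℝ 1 φ := h1.clm_apply contDiff_const
    exact this.differentiable (by norm_num)
  have hsd : Differentiable ℝ s := hs.differentiable (by norm_num)
  have hupd : ∀ w : Fin n → ℝ, (∀ j, w j ∈ Icc (a j) (c j)) → ∀ τ ∈ Icc (a i) (c i),
      Function.update w i τ ∈ K := by
    intro w hw τ hτ j
    by_cases hj : j = i
    · subst hj; simpa using hτ
    · simpa [hj] using hw j
  -- monotonicity of the partial derivative
  have hmon : ∀ τ ∈ Icc (a i) (c i),
      (i ∈ S → φ (Function.update y i τ) ≤ φ (Function.update z i τ)) ∧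
      (i ∉ S → φ (Function.update z i τ) ≤ φ (Function.update y i τ)) := by
    intro τ hτ
    obtain ⟨w, hw, hwe⟩ := domain_mvt (f := φ) (s := K) (f' := fun x => fderiv ℝ φ x)
      (fun x _ => (hφd x).hasFDerivAt.hasFDerivWithinAt) hKc (hupd y hy τ hτ) (hupd z hz τ hτ)
    have hwK : w ∈ K := hKc.segment_subset (hupd y hy τ hτ) (hupd z hz τ hτ) hw
    set v := Function.update z i τ - Function.update y i τ with hv
    have hsum : fderiv ℝ φ w v = ∑ j, v j * partial2 s i j w := by
      conv_lhs => rw [pi_eq_sum_univ' v]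
      rw [map_sum]
      refine Finset.sum_congr rfl fun j _ => ?_
      rw [map_smul, smul_eq_mul]
      rfl
    have hvi : v i = 0 := by simp [hv]
    have hvj : ∀ j, j ≠ i → v j = z j - y j := fun j hj => by simp [hv, hj]
    rw [hsum] at hwe
    constructor
    · intro hiS
      have : 0 ≤ ∑ j, v j * partial2 s i j w := by
        refine Finset.sum_nonneg fun j _ => ?_
        by_cases hj : j = i
        · rw [hj, hvi]; simp
        · rw [hvj j hj]
          by_cases hjS : j ∈ S
          · exact mul_nonneg (sub_nonneg.2 ((hyz j).1 hjS))
              (hsame i j (Ne.symm hj) (Or.inl ⟨hiS, hjS⟩) w hwK)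
          · exact mul_nonneg_of_nonpos_of_nonpos (sub_nonpos.2 ((hyz j).2 hjS))
              (hdiff i j (Ne.symm hj) (by tauto) w hwK)
      linarith
    · intro hiS
      have : ∑ j, v j * partial2 s i j w ≤ 0 := by
        refine Finset.sum_nonpos fun j _ => ?_
        by_cases hj : j = i
        · rw [hj, hvi]; simp
        · rw [hvj j hj]
          by_cases hjS : j ∈ S
          · exact mul_nonpos_of_nonneg_of_nonpos (sub_nonneg.2 ((hyz j).1 hjS))
              (hdiff i j (Ne.symm hj) (by tauto) w hwK)
          · exact mul_nonpos_of_nonpos_of_nonneg (sub_nonpos.2 ((hyz j).2 hjS))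
              (hsame i j (Ne.symm hj) (Or.inr ⟨hiS, hjS⟩) w hwK)
      linarith
  have hder : ∀ w : Fin n → ℝ, ∀ τ, HasDerivAt (fun τ => s (Function.update w i τ))
      (φ (Function.update w i τ)) τ := by
    intro w τ
    exact (hsd _).hasFDerivAt.comp_hasDerivAt τ (hasDerivAt_update w i τ)
  set g : ℝ → ℝ := fun τ => s (Function.update z i τ) - s (Function.update y i τ) with hg
  have hgd : ∀ τ, HasDerivAt g (φ (Function.update z i τ) - φ (Function.update y i τ)) τ :=
    fun τ => (hder z τ).sub (hder y τ)
  have hgc : ContinuousOn g (Icc (a i) (c i)) :=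
    fun τ _ => (hgd τ).continuousAt.continuousWithinAt
  have hfin : g (y i) ≤ g β := by
    by_cases hiS : i ∈ S
    · have : MonotoneOn g (Icc (a i) (c i)) := by
        refine monotoneOn_of_deriv_nonneg (convex_Icc _ _) hgc
          (fun τ _ => (hgd τ).differentiableAt.differentiableWithinAt) fun τ hτ => ?_
        rw [(hgd τ).deriv]
        linarith [(hmon τ (interior_subset hτ)).1 hiS]
      exact this (hy i) hβ (hiβ.1 hiS)
    · have : AntitoneOn g (Icc (a i) (c i)) := by
        refine antitoneOn_of_deriv_nonpos (convex_Icc _ _) hgc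
          (fun τ _ => (hgd τ).differentiableAt.differentiableWithinAt) fun τ hτ => ?_
        rw [(hgd τ).deriv]
        linarith [(hmon τ (interior_subset hτ)).2 hiS]
      exact this hβ (hy i) (hiβ.2 hiS)
  have e1 : Function.update z i (y i) = z := by rw [hi, Function.update_eq_self]
  simp only [hg, e1, Function.update_eq_self] at hfin
  linarith

section Quantile

lemma quantile_le_iff (μ : Measure ℝ) [IsProbabilityMeasure μ] {m : ℝ} (hm : m ∈ Ioo (0:ℝ) 1)
    (x : ℝ) : quantile μ m ≤ x ↔ m ≤ ProbabilityTheory.cdf μ x := by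
  have hset : {x : ℝ | ENNReal.ofReal m ≤ μ (Iic x)} =
      {x | m ≤ ProbabilityTheory.cdf μ x} := by
    ext x
    simp only [mem_ofPred_eq, ← ProbabilityTheory.ofReal_cdf]
    exact ENNReal.ofReal_le_ofReal_iff (ProbabilityTheory.cdf_nonneg μ x)
  unfold quantile
  rw [hset]
  set A := {x | m ≤ ProbabilityTheory.cdf μ x} with hA
  have hbdd : BddBelow A := by
    have := (ProbabilityTheory.tendsto_cdf_atBot μ).eventually_lt_const hm.1
    obtain ⟨y, hy⟩ := this.exists
    refine ⟨y, fun z hz => ?_⟩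
    by_contra hzy
    have := ProbabilityTheory.monotone_cdf μ (not_le.1 hzy).le
    have hz' : m ≤ ProbabilityTheory.cdf μ z := hz
    linarith
  have hne : A.Nonempty := by
    have := (ProbabilityTheory.tendsto_cdf_atTop μ).eventually_const_lt hm.2
    obtain ⟨y, hy⟩ := this.exists
    exact ⟨y, hy.le⟩
  constructor
  · intro h
    have hr : ∀ y, x < y → m ≤ ProbabilityTheory.cdf μ y := by
      intro y hy
      obtain ⟨z, hz, hzy⟩ := exists_lt_of_csInf_lt hne (h.trans_lt hy)
      exact le_trans hz (ProbabilityTheory.monotone_cdf μ hzy.le)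
    have hc := ((ProbabilityTheory.cdf μ).right_continuous x).mono (Ioi_subset_Ici_self)
    refine ge_of_tendsto hc.tendsto ?_
    filter_upwards [self_mem_nhdsWithin] with y hy using hr y hy
  · intro h
    exact csInf_le hbdd h

lemma quantile_mono (μ : Measure ℝ) [IsProbabilityMeasure μ] :
    MonotoneOn (quantile μ) (Ioo 0 1) := by
  intro m hm m' hm' h
  rw [quantile_le_iff μ hm]
  exact h.trans ((quantile_le_iff μ hm' _).1 le_rfl)

lemma lebI_eq : lebI = volume.restrict (Ioo (0:ℝ) 1) :=
  (Measure.restrict_congr_set Ioo_ae_eq_Icc).symm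

instance lebI_prob : IsProbabilityMeasure lebI := by
  constructor
  simp [lebI]

lemma quantile_aem (μ : Measure ℝ) [IsProbabilityMeasure μ] : AEMeasurable (quantile μ) lebI := by
  rw [lebI_eq]
  exact aemeasurable_restrict_of_monotoneOn measurableSet_Ioo (quantile_mono μ)

lemma quantile_map (μ : Measure ℝ) [IsProbabilityMeasure μ] : lebI.map (quantile μ) = μ := by
  have : IsProbabilityMeasure (lebI.map (quantile μ)) :=
    Measure.isProbabilityMeasure_map (quantile_aem μ)
  refine Measure.ext_of_Iic _ _ fun x => ?_
  rw [Measure.map_apply_of_aemeasurable (quantile_aem μ) measurableSet_Iic]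
  have h1 : lebI (quantile μ ⁻¹' Iic x) = lebI (Iic (ProbabilityTheory.cdf μ x)) := by
    apply measure_congr
    have : ∀ᵐ m ∂lebI, m ∈ Ioo (0:ℝ) 1 := by
      rw [lebI_eq]; exact ae_restrict_mem measurableSet_Ioo
    filter_upwards [this] with m hm
    exact propext (quantile_le_iff μ hm x)
  rw [h1, ← ProbabilityTheory.ofReal_cdf μ, lebI, Measure.restrict_apply measurableSet_Iic]
  have : Iic (ProbabilityTheory.cdf μ x) ∩ Icc (0:ℝ) 1 = Icc 0 (ProbabilityTheory.cdf μ x) := by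
    ext m
    have := ProbabilityTheory.cdf_le_one μ x
    simp only [mem_inter_iff, mem_Iic, mem_Icc]
    constructor
    · tauto
    · rintro ⟨h1, h2⟩; exact ⟨h2, h1, by linarith⟩
  rw [this]; simp

lemma refl_mp : MeasurePreserving (fun m : ℝ => 1 - m) lebI lebI := by
  have h := (Measure.measurePreserving_sub_left (volume : Measure ℝ) 1).restrict_preimage
    (measurableSet_Icc (a := (0:ℝ)) (b := 1))
  have : (fun m : ℝ => 1 - m) ⁻¹' Icc 0 1 = Icc 0 1 := by simp
  rw [this] at h
  exact h

end Quantile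

/-- monotone discretization -/
noncomputable def disc (a c : ℝ) (k : ℕ) (x : ℝ) : ℝ :=
  max a ((⌊((k:ℝ)+1) * min c (max a x)⌋ : ℝ) / ((k:ℝ)+1))

lemma disc_mono (a c : ℝ) (k : ℕ) : Monotone (disc a c k) := by
  intro x y h
  unfold disc
  gcongr

lemma disc_mem {a c : ℝ} (hac : a ≤ c) (k : ℕ) (x : ℝ) : disc a c k x ∈ Icc a c := by
  refine ⟨le_max_left _ _, max_le hac ?_⟩
  rw [div_le_iff₀ (by positivity)]
  have h1 := Int.floor_le (((k:ℝ)+1) * min c (max a x))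
  have h2 : ((k:ℝ)+1) * min c (max a x) ≤ ((k:ℝ)+1) * c := by
    gcongr; exact min_le_left _ _
  linarith

lemma disc_finite {a c : ℝ} (hac : a ≤ c) (k : ℕ) : (range (disc a c k)).Finite := by
  have : range (disc a c k) ⊆ (fun j : ℤ => max a ((j:ℝ) / ((k:ℝ)+1))) ''
      (Icc ⌊((k:ℝ)+1) * a⌋ ⌊((k:ℝ)+1) * c⌋) := by
    rintro _ ⟨x, rfl⟩
    refine ⟨⌊((k:ℝ)+1) * min c (max a x)⌋, ⟨?_, ?_⟩, rfl⟩
    · apply Int.floor_mono; gcongr; exact le_min hac (le_max_left _ _)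
    · apply Int.floor_mono; gcongr; exact min_le_left _ _
  exact ((finite_Icc _ _).image _).subset this

lemma disc_tendsto {a c x : ℝ} (hx : x ∈ Icc a c) :
    Tendsto (fun k : ℕ => disc a c k x) atTop (𝓝 x) := by
  have hcl : min c (max a x) = x := by rw [max_eq_right hx.1, min_eq_right hx.2]
  have h1 : Tendsto (fun k : ℕ => x - 1 / ((k:ℝ)+1)) atTop (𝓝 x) := by
    simpa using tendsto_const_nhds.sub (tendsto_one_div_add_atTop_nhds_zero_nat (𝕜 := ℝ))
  refine tendsto_of_tendsto_of_tendsto_of_le_of_le h1 tendsto_const_nhds ?_ ?_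
  · intro k
    have hk : (0:ℝ) < (k:ℝ)+1 := by positivity
    refine le_trans ?_ (le_max_right _ _)
    rw [hcl, le_div_iff₀ hk, sub_mul, one_div, inv_mul_cancel₀ hk.ne']
    linarith [Int.lt_floor_add_one (((k:ℝ)+1) * x)]
  · intro k
    have hk : (0:ℝ) < (k:ℝ)+1 := by positivity
    refine max_le hx.1 ?_
    rw [hcl, div_le_iff₀ hk]
    linarith [Int.floor_le (((k:ℝ)+1) * x)]

/-- simple-function version -/
noncomputable def discS (a c : ℝ) (hac : a ≤ c) (k : ℕ) : SimpleFunc ℝ ℝ where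
  toFun := disc a c k
  measurableSet_fiber' y := (disc_mono a c k).measurable (measurableSet_singleton y)
  finite_range' := disc_finite hac k

/-- for a weakly compatible C² surplus `s` on a product of bounded
real intervals (with sign partition `Splus`/its complement, `0 ∈ Splus`), the
`s`-comonotone coupling `π = (G_0,...,G_d)_# Leb_{[0,1]}` maximizes
`∫ s dπ` over `Γ(μ_0,...,μ_d)`. -/
theorem stmt1 (d : ℕ) (a c : Fin (d+1) → ℝ) (hac : ∀ i, a i ≤ c i)
    (μ : Fin (d+1) → Measure ℝ) (hprob : ∀ i, IsProbabilityMeasure (μ i))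
    (hsupp : ∀ i, μ i (Icc (a i) (c i)) = 1)
    (s : (Fin (d+1) → ℝ) → ℝ) (hs : ContDiff ℝ 2 s)
    (K : Set (Fin (d+1) → ℝ)) (hK : K = {x | ∀ i, x i ∈ Icc (a i) (c i)})
    (Splus : Set (Fin (d+1))) (h0 : (0 : Fin (d+1)) ∈ Splus)
    (hsign_same : ∀ i j, i ≠ j → ((i ∈ Splus ∧ j ∈ Splus) ∨ (i ∉ Splus ∧ j ∉ Splus)) →
      ∀ x ∈ K, 0 ≤ partial2 s i j x)
    (hsign_diff : ∀ i j, i ≠ j → ¬((i ∈ Splus ∧ j ∈ Splus) ∨ (i ∉ Splus ∧ j ∉ Splus)) →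
      ∀ x ∈ K, partial2 s i j x ≤ 0)
    (hweak : ∀ i j k : Fin (d+1), i ≠ j → j ≠ k → i ≠ k →
      ∀ x ∈ K, 0 ≤ partial2 s i j x * partial2 s k j x * partial2 s k i x)
    (G : Fin (d+1) → ℝ → ℝ)
    (hG : ∀ i m, G i m = if i ∈ Splus then quantile (μ i) m else quantile (μ i) (1 - m))
    (π : Measure (Fin (d+1) → ℝ)) (hπ : π = lebI.map (fun m i => G i m)) :
    (IsProbabilityMeasure π ∧ ∀ i, π.map (fun x => x i) = μ i) ∧
    (∀ π' : Measure (Fin (d+1) → ℝ), IsProbabilityMeasure π' →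
      (∀ i, π'.map (fun x => x i) = μ i) →
      ∫ x, s x ∂π' ≤ ∫ x, s x ∂π) := by
  subst hK
  have hprobI := hprob
  have hIoo : ∀ᵐ m ∂lebI, m ∈ Ioo (0:ℝ) 1 := by
    rw [lebI_eq]; exact ae_restrict_mem measurableSet_Ioo
  have hGi : ∀ i, G i = if i ∈ Splus then quantile (μ i) else fun m => quantile (μ i) (1 - m) := by
    intro i; funext m; rw [hG]; split_ifs <;> rfl
  have hGm : ∀ i, AEMeasurable (G i) lebI ∧ lebI.map (G i) = μ i := by
    intro i
    rw [hGi]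
    split_ifs with h
    · exact ⟨quantile_aem _, quantile_map _⟩
    · have hq : AEMeasurable (quantile (μ i)) (lebI.map (fun m : ℝ => 1 - m)) := by
        rw [refl_mp.map_eq]; exact quantile_aem _
      refine ⟨hq.comp_aemeasurable refl_mp.measurable.aemeasurable, ?_⟩
      have := AEMeasurable.map_map_of_aemeasurable hq refl_mp.measurable.aemeasurable
      rw [refl_mp.map_eq, quantile_map] at this
      exact this.symm
  have hγ : AEMeasurable (fun m i => G i m) lebI := aemeasurable_pi_lambda _ fun i => (hGm i).1
  have hπp : IsProbabilityMeasure π := by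
    rw [hπ]; exact Measure.isProbabilityMeasure_map hγ
  have hπm : ∀ i, π.map (fun x => x i) = μ i := by
    intro i
    rw [hπ, AEMeasurable.map_map_of_aemeasurable (measurable_pi_apply i).aemeasurable hγ]
    exact (hGm i).2
  refine ⟨⟨hπp, hπm⟩, fun π' hπ'p hπ'm => ?_⟩
  set R : ℕ → (Fin (d+1) → ℝ) → (Fin (d+1) → ℝ) :=
    fun k x i => disc (a i) (c i) k (x i) with hR
  have hRm : ∀ k, Measurable (R k) := fun k => measurable_pi_lambda _ fun i =>
    (disc_mono _ _ k).measurable.comp (measurable_pi_apply i)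
  have hKc : IsCompact {x : Fin (d+1) → ℝ | ∀ i, x i ∈ Icc (a i) (c i)} :=
    isCompact_pi_infinite fun i => isCompact_Icc
  obtain ⟨B, hB⟩ := hKc.exists_bound_of_continuousOn hs.continuous.continuousOn
  have hRB : ∀ k x, ‖s (R k x)‖ ≤ B := fun k x => hB _ fun i => disc_mem (hac i) k (x i)
  have hlim : ∀ ν : Measure (Fin (d+1) → ℝ), IsProbabilityMeasure ν →
      (∀ i, ν.map (fun x => x i) = μ i) →
      Tendsto (fun k => ∫ x, s (R k x) ∂ν) atTop (𝓝 (∫ x, s x ∂ν)) := by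
    intro ν hν hνm
    have hνK : ∀ᵐ x ∂ν, ∀ i, x i ∈ Icc (a i) (c i) := by
      rw [ae_all_iff]
      intro i
      have h1 : ∀ᵐ y ∂(μ i), y ∈ Icc (a i) (c i) :=
        (mem_ae_iff_prob_eq_one measurableSet_Icc).2 (hsupp i)
      rw [← hνm i] at h1
      exact ae_of_ae_map (measurable_pi_apply i).aemeasurable h1
    refine tendsto_integral_of_dominated_convergence (fun _ => B)
      (fun k => (hs.continuous.measurable.comp (hRm k)).aestronglyMeasurable)
      (integrable_const _) (fun k => Eventually.of_forall (hRB k)) ?_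
    filter_upwards [hνK] with x hx
    exact (hs.continuous.tendsto x).comp (tendsto_pi_nhds.2 fun i => disc_tendsto (hx i))
  refine le_of_tendsto_of_tendsto' (hlim π' hπ'p hπ'm) (hlim π hπp hπm) fun k => ?_
  have hGmono : ∀ m ∈ Ioo (0:ℝ) 1, ∀ m' ∈ Ioo (0:ℝ) 1, m ≤ m' → ∀ i,
      ordRel Splus i (G i m) (G i m') := by
    intro m hm m' hm' h i
    constructor
    · intro hi
      simp only [hG, if_pos hi]
      exact quantile_mono (μ i) hm hm' h
    · intro hi
      simp only [hG, if_neg hi]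
      exact quantile_mono (μ i) ⟨by linarith [hm'.2], by linarith [hm'.1]⟩
        ⟨by linarith [hm.2], by linarith [hm.1]⟩ (by linarith)
  obtain ⟨u, hu1, hu2⟩ := exists_pot (r := ordRel Splus) (I := fun i => Icc (a i) (c i)) (f := s)
    (fun i x => ⟨fun _ => le_rfl, fun _ => le_rfl⟩)
    (fun i x y z h1 h2 => ⟨fun h => (h1.1 h).trans (h2.1 h), fun h => (h2.2 h).trans (h1.2 h)⟩)
    (fun i x y h1 h2 => by
      by_cases h : i ∈ Splus
      · exact le_antisymm (h1.1 h) (h2.1 h)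
      · exact le_antisymm (h2.2 h) (h1.2 h))
    (incrDiff_of a c s hs Splus hsign_same hsign_diff)
    (fun i => if i ∈ Splus then a i else c i)
    (fun i => by
      by_cases h : i ∈ Splus
      · simp [h, hac i]
      · simp [h, hac i])
    (fun i x hx => ⟨fun h => by simpa [h] using hx.1, fun h => by simpa [h] using hx.2⟩)
    (Ioo 0 1) (fun m => R k (fun i => G i m)) (fun m _ i => disc_mem (hac i) k _)
    (fun m hm m' hm' h i => ⟨fun hi => disc_mono _ _ k ((hGmono m hm m' hm' h i).1 hi),
      fun hi => disc_mono _ _ k ((hGmono m hm m' hm' h i).2 hi)⟩)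
    ((Set.Finite.pi' fun i => disc_finite (hac i) k).subset (by
      rintro _ ⟨m, _, rfl⟩ i
      exact mem_range_self _))
  set U : Fin (d+1) → SimpleFunc ℝ ℝ := fun i => (discS (a i) (c i) (hac i) k).map (u i) with hU
  have hUapp : ∀ i x, U i x = u i (disc (a i) (c i) k x) := fun i x => rfl
  have hint : ∀ ν : Measure (Fin (d+1) → ℝ), IsProbabilityMeasure ν →
      (∀ i, ν.map (fun x => x i) = μ i) →
      Integrable (fun x => ∑ i, U i (x i)) ν ∧
      ∫ x, ∑ i, U i (x i) ∂ν = ∑ i, ∫ y, U i y ∂(μ i) := by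
    intro ν hν hνm
    have hi : ∀ i, Integrable (fun x : Fin (d+1) → ℝ => U i (x i)) ν := by
      intro i
      have h1 : Integrable (U i) (ν.map (fun x => x i)) := by
        rw [hνm i]; exact SimpleFunc.integrable_of_isFiniteMeasure _
      exact h1.comp_measurable (measurable_pi_apply i)
    refine ⟨integrable_finsetSum _ fun i _ => hi i, ?_⟩
    rw [integral_finsetSum _ fun i _ => hi i]
    refine Finset.sum_congr rfl fun i _ => ?_
    rw [← hνm i, integral_map (measurable_pi_apply i).aemeasurable
      (U i).measurable.aestronglyMeasurable]
  have hsint : ∀ ν : Measure (Fin (d+1) → ℝ), IsProbabilityMeasure ν →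
      Integrable (fun x => s (R k x)) ν := fun ν hν =>
    Integrable.of_bound (hs.continuous.measurable.comp (hRm k)).aestronglyMeasurable B
      (Eventually.of_forall (hRB k))
  have hle : ∫ x, s (R k x) ∂π' ≤ ∫ x, ∑ i, U i (x i) ∂π' := by
    refine integral_mono_ae (hsint π' hπ'p) (hint π' hπ'p hπ'm).1 ?_
    have hae : ∀ᵐ x ∂π', ∀ i, ∃ m ∈ Ioo (0:ℝ) 1, R k (fun i => G i m) i = R k x i := by
      rw [ae_all_iff]
      intro i
      have hms : MeasurableSet {y : ℝ | ∃ m ∈ Ioo (0:ℝ) 1,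
          disc (a i) (c i) k (G i m) = disc (a i) (c i) k y} :=
        (discS (a i) (c i) (hac i) k).measurableSet_preimage
          {z | ∃ m ∈ Ioo (0:ℝ) 1, disc (a i) (c i) k (G i m) = z}
      have h1 : ∀ᵐ y ∂(μ i), ∃ m ∈ Ioo (0:ℝ) 1,
          disc (a i) (c i) k (G i m) = disc (a i) (c i) k y := by
        rw [← (hGm i).2, ae_map_iff (hGm i).1 hms]
        filter_upwards [hIoo] with m hm
        exact ⟨m, hm, rfl⟩
      rw [← hπ'm i] at h1
      exact ae_of_ae_map (measurable_pi_apply i).aemeasurable h1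
    filter_upwards [hae] with x hx
    exact hu2 (R k x) hx
  have heq : ∫ x, s (R k x) ∂π = ∫ x, ∑ i, U i (x i) ∂π := by
    have hUm : Measurable (fun x : Fin (d+1) → ℝ => ∑ i, U i (x i)) :=
      Finset.measurable_sum _ fun i _ => (U i).measurable.comp (measurable_pi_apply i)
    have hsm : Measurable (fun x => s (R k x)) := hs.continuous.measurable.comp (hRm k)
    rw [hπ, integral_map hγ hsm.aestronglyMeasurable,
      integral_map hγ hUm.aestronglyMeasurable]
    refine integral_congr_ae ?_
    filter_upwards [hIoo] with m hm
    exact hu1 m hm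
  rw [heq, (hint π hπp hπm).2, ← (hint π' hπ'p hπ'm).2]
  exact hle
end

section
/- Let X_i ⊂ ℝ be compact intervals and μ_i, ν_i ∈ P(X_i) for i = 1, ..., d. Let α : [0,1] → [0,∞) be nondecreasing with α ≤ M. Let b ∈ C²(X_1 × ... × X_d) be weakly compatible with associated partition S_+ ∪ S_-, monotone increasing in each x_i with i ∈ S_+ and monotone decreasing in each x_i with i ∈ S_-, and K-Lipschitz with respect to the ℓ^p norm on ℝ^d. Then |max_{γ ∈ Γ(μ_1,...,μ_d)} R_α(b_# γ) - max_{γ ∈ Γ(ν_1,...,ν_d)} R_α(b_# γ)| ≤ M K (Σ_{i=1}^d W_p(μ_i, ν_i)^p)^{1/p}. -/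
open MeasureTheory Set
open scoped Classical

/-- The spectral risk measure `R_α(μ) = ∫_0^1 F_μ⁻¹(m) α(m) dm`. -/
noncomputable def specRisk (α : ℝ → ℝ) (μ : Measure ℝ) : ℝ :=
  ∫ m in Icc (0:ℝ) 1, quantile μ m * α m

/-- The `p`-Wasserstein distance between two probability measures on ℝ, defined as
the infimum over couplings of `(∫ |x-y|^p dπ)^(1/p)`. -/
noncomputable def Wp (p : ℝ) (μ ν : Measure ℝ) : ℝ :=
  sInf {w : ℝ | ∃ π : Measure (ℝ × ℝ), IsProbabilityMeasure π ∧
    π.map Prod.fst = μ ∧ π.map Prod.snd = ν ∧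
    w = (∫ q : ℝ × ℝ, |q.1 - q.2| ^ p ∂π) ^ (1/p)}

open ProbabilityTheory Filter Topology

lemma cdf_of_ge {μ : Measure ℝ} [IsProbabilityMeasure μ] {B : ℝ}
    (hB : μ (Icc (-B) B) = 1) : cdf μ B = 1 := by
  have h : μ (Iic B) = 1 := le_antisymm prob_le_one (hB ▸ measure_mono Icc_subset_Iic_self)
  rw [cdf_eq_real, measureReal_def, h]; simp

lemma cdf_of_lt {μ : Measure ℝ} [IsProbabilityMeasure μ] {B x : ℝ}
    (hB : μ (Icc (-B) B) = 1) (hx : x < -B) : cdf μ x = 0 := by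
  have h0 : μ (Icc (-B) B)ᶜ = 0 := (prob_compl_eq_zero_iff measurableSet_Icc).2 hB
  have h : μ (Iic x) = 0 := by
    refine measure_mono_null (fun y hy => ?_) h0
    intro h
    have := h.1
    have : y ≤ x := hy
    linarith
  rw [cdf_eq_real, measureReal_def, h]; simp

lemma quantile_set (μ : Measure ℝ) [IsProbabilityMeasure μ] (m : ℝ) :
    {x : ℝ | ENNReal.ofReal m ≤ μ (Iic x)} = {x | m ≤ cdf μ x} := by
  ext x
  simp only [mem_ofPred_eq, ← ofReal_cdf]
  exact ENNReal.ofReal_le_ofReal_iff (cdf_nonneg μ x)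

lemma quantile_le_iff_s15 {μ : Measure ℝ} [IsProbabilityMeasure μ] {B m : ℝ}
    (hB : μ (Icc (-B) B) = 1) (hm : m ∈ Ioc (0:ℝ) 1) (t : ℝ) :
    quantile μ m ≤ t ↔ m ≤ cdf μ t := by
  have hne : ({x | m ≤ cdf μ x}).Nonempty := ⟨B, by
    simp only [mem_ofPred_eq, cdf_of_ge hB]; exact hm.2⟩
  have hbd : BddBelow {x | m ≤ cdf μ x} := ⟨-B, fun x hx => by
    by_contra h
    have := cdf_of_lt hB (not_le.1 h)
    have h2 : m ≤ cdf μ x := hx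
    rw [this] at h2
    exact absurd hm.1 (not_lt.2 h2)⟩
  unfold quantile
  rw [quantile_set]
  constructor
  · intro h
    refine le_trans ?_ (monotone_cdf μ h)
    set q := sInf {x | m ≤ cdf μ x}
    have hc : Tendsto (cdf μ) (𝓝[>] q) (𝓝 (cdf μ q)) :=
      ((cdf μ).right_continuous q).mono_left (nhdsWithin_mono _ Ioi_subset_Ici_self)
    refine ge_of_tendsto hc (eventually_nhdsWithin_of_forall fun y hy => ?_)
    obtain ⟨z, hz, hzy⟩ := exists_lt_of_csInf_lt hne hy
    exact le_trans hz (monotone_cdf μ hzy.le)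
  · intro h
    exact csInf_le hbd h

lemma quantile_abs_le {μ : Measure ℝ} [IsProbabilityMeasure μ] {B m : ℝ}
    (hB : μ (Icc (-B) B) = 1) (hm : m ∈ Ioc (0:ℝ) 1) : |quantile μ m| ≤ B := by
  rw [abs_le]
  constructor
  · by_contra h
    have h1 := (quantile_le_iff_s15 hB hm _).1 le_rfl
    rw [cdf_of_lt hB (not_le.1 h)] at h1
    exact absurd hm.1 (not_lt.2 h1)
  · rw [quantile_le_iff_s15 hB hm, cdf_of_ge hB]; exact hm.2

lemma quantile_monoOn {μ : Measure ℝ} [IsProbabilityMeasure μ] {B : ℝ}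
    (hB : μ (Icc (-B) B) = 1) : MonotoneOn (quantile μ) (Ioc 0 1) := by
  intro x hx y hy hxy
  rw [quantile_le_iff_s15 hB hx]
  exact hxy.trans ((quantile_le_iff_s15 hB hy _).1 le_rfl)

lemma lint_Ico (u v : ℝ) :
    ∫⁻ t, (Ico (min u v) (max u v)).indicator (fun _ => (1:ENNReal)) t
      = ENNReal.ofReal |u - v| := by
  rw [lintegral_indicator measurableSet_Ico]
  simp only [lintegral_const, one_mul, Measure.restrict_apply_univ, Real.volume_Ico]
  rw [max_sub_min_eq_abs, abs_sub_comm]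

lemma quantile_W1 {Ω : Type*} [MeasurableSpace Ω] (P : Measure Ω) [IsProbabilityMeasure P]
    (U V : Ω → ℝ) (hU : Measurable U) (hV : Measurable V) (B : ℝ)
    (hUB : (P.map U) (Icc (-B) B) = 1) (hVB : (P.map V) (Icc (-B) B) = 1) :
    ∫⁻ m in Ioc (0:ℝ) 1, ENNReal.ofReal |quantile (P.map U) m - quantile (P.map V) m|
      ≤ ∫⁻ ω, ENNReal.ofReal |U ω - V ω| ∂P := by
  have := Measure.isProbabilityMeasure_map (μ := P) hU.aemeasurable
  have := Measure.isProbabilityMeasure_map (μ := P) hV.aemeasurable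
  set F := cdf (P.map U) with hF
  set G := cdf (P.map V) with hG
  have hFm : Measurable F := (monotone_cdf _).measurable
  have hGm : Measurable G := (monotone_cdf _).measurable
  have hS1 : MeasurableSet {z : ℝ × ℝ | min (F z.2) (G z.2) < z.1 ∧
      z.1 ≤ max (F z.2) (G z.2)} := by
    have h1 : Measurable fun z : ℝ × ℝ => F z.2 := hFm.comp measurable_snd
    have h2 : Measurable fun z : ℝ × ℝ => G z.2 := hGm.comp measurable_snd
    exact MeasurableSet.inter (measurableSet_lt (h1.min h2) measurable_fst)
      (measurableSet_le measurable_fst (h1.max h2))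
  have hS2 : MeasurableSet {z : Ω × ℝ | min (U z.1) (V z.1) ≤ z.2 ∧
      z.2 < max (U z.1) (V z.1)} := by
    have h1 : Measurable fun z : Ω × ℝ => U z.1 := hU.comp measurable_fst
    have h2 : Measurable fun z : Ω × ℝ => V z.1 := hV.comp measurable_fst
    exact MeasurableSet.inter (measurableSet_le (h1.min h2) measurable_snd)
      (measurableSet_lt measurable_snd (h1.max h2))
  calc ∫⁻ m in Ioc (0:ℝ) 1, ENNReal.ofReal |quantile (P.map U) m - quantile (P.map V) m|
      = ∫⁻ m in Ioc (0:ℝ) 1, ∫⁻ t, {z : ℝ × ℝ | min (F z.2) (G z.2) < z.1 ∧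
          z.1 ≤ max (F z.2) (G z.2)}.indicator (fun _ => (1:ENNReal)) (m, t) := by
        refine setLIntegral_congr_fun measurableSet_Ioc (fun m hm => ?_)
        rw [← lint_Ico]
        refine lintegral_congr fun t => ?_
        have h1 := quantile_le_iff_s15 hUB hm t
        have h2 := quantile_le_iff_s15 hVB hm t
        rw [← hF] at h1
        rw [← hG] at h2
        simp only [indicator, mem_Ico, mem_ofPred_eq]
        congr 1
        simp only [min_le_iff, max_le_iff, le_min_iff, le_max_iff, ← not_le, h1, h2, eq_iff_iff]
        tauto
    _ = ∫⁻ t, ∫⁻ m in Ioc (0:ℝ) 1, {z : ℝ × ℝ | min (F z.2) (G z.2) < z.1 ∧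
          z.1 ≤ max (F z.2) (G z.2)}.indicator (fun _ => (1:ENNReal)) (m, t) := by
        refine lintegral_lintegral_swap (Measurable.aemeasurable ?_)
        refine Measurable.indicator measurable_const ?_
        exact hS1
    _ ≤ ∫⁻ t, ENNReal.ofReal |F t - G t| := by
        refine lintegral_mono fun t => ?_
        calc _ ≤ ∫⁻ m, (Ioc (min (F t) (G t)) (max (F t) (G t))).indicator
                  (fun _ => (1:ENNReal)) m := setLIntegral_le_lintegral _ _
          _ = _ := by
            rw [lintegral_indicator measurableSet_Ioc]
            simp only [lintegral_const, one_mul, Measure.restrict_apply_univ, Real.volume_Ioc]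
            rw [max_sub_min_eq_abs, abs_sub_comm]
    _ ≤ ∫⁻ t, ∫⁻ ω, {z : Ω × ℝ | min (U z.1) (V z.1) ≤ z.2 ∧
          z.2 < max (U z.1) (V z.1)}.indicator (fun _ => (1:ENNReal)) (ω, t) ∂P := by
        refine lintegral_mono fun t => ?_
        have e : ∫⁻ ω, {z : Ω × ℝ | min (U z.1) (V z.1) ≤ z.2 ∧
          z.2 < max (U z.1) (V z.1)}.indicator (fun _ => (1:ENNReal)) (ω, t) ∂P
          = P {ω | min (U ω) (V ω) ≤ t ∧ t < max (U ω) (V ω)} := by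
          rw [← lintegral_indicator_one]
          · rfl
          · exact hS2.preimage (measurable_id.prodMk measurable_const)
        simp only
        rw [e]
        have hFt : F t = P.real (U ⁻¹' Iic t) := by
          rw [hF, cdf_eq_real, map_measureReal_apply hU measurableSet_Iic]
        have hGt : G t = P.real (V ⁻¹' Iic t) := by
          rw [hG, cdf_eq_real, map_measureReal_apply hV measurableSet_Iic]
        refine ENNReal.ofReal_le_of_le_toReal ?_
        rw [← measureReal_def, hFt, hGt, abs_sub_le_iff]
        have key : ∀ A A' C : Set Ω, A ⊆ A' ∪ C → P.real A - P.real A' ≤ P.real C := by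
          intro A A' C h
          have := (measureReal_mono (μ := P) h).trans (measureReal_union_le A' C)
          linarith
        constructor <;> refine key _ _ _ fun ω hω => ?_
        · by_cases h : V ω ≤ t
          · exact Or.inl h
          · exact Or.inr ⟨min_le_of_left_le hω, lt_max_of_lt_right (not_le.1 h)⟩
        · by_cases h : U ω ≤ t
          · exact Or.inl h
          · exact Or.inr ⟨min_le_of_right_le hω, lt_max_of_lt_left (not_le.1 h)⟩
    _ = ∫⁻ ω, (∫⁻ t, {z : Ω × ℝ | min (U z.1) (V z.1) ≤ z.2 ∧
          z.2 < max (U z.1) (V z.1)}.indicator (fun _ => (1:ENNReal)) (ω, t)) ∂P := by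
        refine (lintegral_lintegral_swap (Measurable.aemeasurable ?_)).symm
        refine Measurable.indicator measurable_const ?_
        exact hS2
    _ = ∫⁻ ω, ENNReal.ofReal |U ω - V ω| ∂P := by
        refine lintegral_congr fun ω => ?_
        rw [← lint_Ico]
        rfl

lemma specRisk_eq (α : ℝ → ℝ) (μ : Measure ℝ) :
    specRisk α μ = ∫ m in Ioc (0:ℝ) 1, quantile μ m * α m := integral_Icc_eq_integral_Ioc

lemma quantile_integrable {μ : Measure ℝ} [IsProbabilityMeasure μ] {B : ℝ}
    (hB : μ (Icc (-B) B) = 1) : IntegrableOn (quantile μ) (Ioc 0 1) := by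
  refine Integrable.of_bound (C := B)
    (aemeasurable_restrict_of_monotoneOn measurableSet_Ioc (quantile_monoOn hB)).aestronglyMeasurable
    ?_
  filter_upwards [ae_restrict_mem measurableSet_Ioc] with m hm using quantile_abs_le hB hm

lemma prod_integrable {μ : Measure ℝ} [IsProbabilityMeasure μ] {B M : ℝ} {α : ℝ → ℝ}
    (hα_mono : MonotoneOn α (Icc 0 1))
    (hα_nonneg : ∀ m ∈ Icc (0:ℝ) 1, 0 ≤ α m)
    (hα_bdd : ∀ m ∈ Icc (0:ℝ) 1, α m ≤ M)
    (hB : μ (Icc (-B) B) = 1) : IntegrableOn (fun m => quantile μ m * α m) (Ioc 0 1) := by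
  refine Integrable.mul_bdd (c := M) (quantile_integrable hB)
    (aemeasurable_restrict_of_monotoneOn measurableSet_Ioc
      (hα_mono.mono Ioc_subset_Icc_self)).aestronglyMeasurable ?_
  filter_upwards [ae_restrict_mem measurableSet_Ioc] with m hm
  rw [Real.norm_eq_abs, abs_of_nonneg (hα_nonneg m (Ioc_subset_Icc_self hm))]
  exact hα_bdd m (Ioc_subset_Icc_self hm)

lemma specRisk_bound {μ : Measure ℝ} [IsProbabilityMeasure μ] {B M : ℝ} {α : ℝ → ℝ}
    (hα_nonneg : ∀ m ∈ Icc (0:ℝ) 1, 0 ≤ α m)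
    (hα_bdd : ∀ m ∈ Icc (0:ℝ) 1, α m ≤ M)
    (hB : μ (Icc (-B) B) = 1) : |specRisk α μ| ≤ B * M := by
  rw [specRisk_eq]
  have := norm_setIntegral_le_of_norm_le_const (μ := volume) (s := Ioc (0:ℝ) 1) (C := B * M)
    (f := fun m => quantile μ m * α m) (by simp) (fun m hm => by
      rw [norm_mul, Real.norm_eq_abs, Real.norm_eq_abs,
        abs_of_nonneg (hα_nonneg m (Ioc_subset_Icc_self hm))]
      have h1 := quantile_abs_le hB hm
      exact mul_le_mul h1 (hα_bdd m (Ioc_subset_Icc_self hm))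
        (hα_nonneg m (Ioc_subset_Icc_self hm)) ((abs_nonneg _).trans h1))
  simpa using this

lemma specRisk_diff {Ω : Type*} [MeasurableSpace Ω] (P : Measure Ω) [IsProbabilityMeasure P]
    (U V : Ω → ℝ) (hU : Measurable U) (hV : Measurable V) (B M : ℝ) (α : ℝ → ℝ)
    (hα_mono : MonotoneOn α (Icc 0 1))
    (hα_nonneg : ∀ m ∈ Icc (0:ℝ) 1, 0 ≤ α m)
    (hα_bdd : ∀ m ∈ Icc (0:ℝ) 1, α m ≤ M)
    (hUB : (P.map U) (Icc (-B) B) = 1) (hVB : (P.map V) (Icc (-B) B) = 1)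
    (hint : Integrable (fun ω => |U ω - V ω|) P) :
    |specRisk α (P.map U) - specRisk α (P.map V)| ≤ M * ∫ ω, |U ω - V ω| ∂P := by
  have := Measure.isProbabilityMeasure_map (μ := P) hU.aemeasurable
  have := Measure.isProbabilityMeasure_map (μ := P) hV.aemeasurable
  have hM : 0 ≤ M := (hα_nonneg 0 (by simp)).trans (hα_bdd 0 (by simp))
  have hi : IntegrableOn (fun m => |quantile (P.map U) m - quantile (P.map V) m|) (Ioc 0 1) :=
    ((quantile_integrable hUB).sub (quantile_integrable hVB)).abs
  rw [specRisk_eq, specRisk_eq, ← integral_sub (prod_integrable hα_mono hα_nonneg hα_bdd hUB)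
    (prod_integrable hα_mono hα_nonneg hα_bdd hVB)]
  calc _ ≤ ∫ m in Ioc (0:ℝ) 1, M * |quantile (P.map U) m - quantile (P.map V) m| := by
        rw [← Real.norm_eq_abs]
        refine norm_integral_le_of_norm_le (hi.const_mul M) ?_
        filter_upwards [ae_restrict_mem measurableSet_Ioc] with m hm
        rw [← sub_mul, norm_mul, mul_comm, Real.norm_eq_abs, Real.norm_eq_abs,
          abs_of_nonneg (hα_nonneg m (Ioc_subset_Icc_self hm))]
        exact mul_le_mul_of_nonneg_right (hα_bdd m (Ioc_subset_Icc_self hm)) (abs_nonneg _)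
    _ = M * ∫ m in Ioc (0:ℝ) 1, |quantile (P.map U) m - quantile (P.map V) m| :=
        integral_const_mul _ _
    _ ≤ _ := by
        refine mul_le_mul_of_nonneg_left ?_ hM
        have h := quantile_W1 P U V hU hV B hUB hVB
        rw [integral_eq_lintegral_of_nonneg_ae (ae_of_all _ fun _ => abs_nonneg _)
          hi.aestronglyMeasurable,
          integral_eq_lintegral_of_nonneg_ae (ae_of_all _ fun _ => abs_nonneg _)
          hint.aestronglyMeasurable]
        refine ENNReal.toReal_mono ?_ h
        exact hint.lintegral_lt_top.ne

lemma glue {d : ℕ} (γ : Measure (Fin d → ℝ)) [IsProbabilityMeasure γ]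
    (π : Fin d → Measure (ℝ × ℝ)) (hπ : ∀ i, IsProbabilityMeasure (π i))
    (hfst : ∀ i, (π i).map Prod.fst = γ.map (fun z => z i)) :
    ∃ Y : (Fin d → ℝ) × unitInterval → Fin d → ℝ, Measurable Y ∧
      ∀ i, (γ.prod (volume : Measure unitInterval)).map (fun ω => (ω.1 i, Y ω i)) = π i := by
  have h : ∀ i, ∃ f : ℝ → unitInterval → ℝ, Measurable (Function.uncurry f) ∧
      ∀ x, (volume : Measure unitInterval).map (f x) = (π i).condKernel x :=
    fun i => Kernel.exists_measurable_map_eq_unitInterval (π i).condKernel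
  choose f hf hfm using h
  have hYi : ∀ i, Measurable fun ω : (Fin d → ℝ) × unitInterval => f i (ω.1 i) ω.2 := fun i =>
    (hf i).comp (g := Function.uncurry (f i))
      (f := fun ω : (Fin d → ℝ) × unitInterval => (ω.1 i, ω.2))
      (((measurable_pi_apply i).comp measurable_fst).prodMk measurable_snd)
  refine ⟨fun ω i => f i (ω.1 i) ω.2, measurable_pi_lambda _ hYi, fun i => ?_⟩
  have hpair : Measurable fun ω : (Fin d → ℝ) × unitInterval => (ω.1 i, f i (ω.1 i) ω.2) :=
    ((measurable_pi_apply i).comp measurable_fst).prodMk (hYi i)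
  ext s hs
  conv_rhs => rw [← (π i).disintegrate (π i).condKernel]
  rw [Measure.map_apply hpair hs, Measure.prod_apply (hpair hs), Measure.compProd_apply hs,
    Measure.fst, hfst i, lintegral_map (Kernel.measurable_kernel_prodMk_left hs)
      (measurable_pi_apply i)]
  refine lintegral_congr fun x => ?_
  rw [← hfm, Measure.map_apply ((hf i).of_uncurry_left) (measurable_prodMk_left hs)]
  rfl

lemma pi_supp {d : ℕ} {a c : Fin d → ℝ} {μ : Fin d → Measure ℝ}
    (hμ_supp : ∀ i, μ i (Icc (a i) (c i)) = 1)
    {γ : Measure (Fin d → ℝ)} [IsProbabilityMeasure γ] (hγ : ∀ i, γ.map (fun z => z i) = μ i) :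
    ∀ᵐ z ∂γ, ∀ i, z i ∈ Icc (a i) (c i) := by
  rw [ae_all_iff]
  intro i
  have h1 := hμ_supp i
  rw [← hγ i, Measure.map_apply (measurable_pi_apply i) measurableSet_Icc] at h1
  exact (mem_ae_iff_prob_eq_one ((measurable_pi_apply i) measurableSet_Icc)).2 h1

lemma map_supp {d : ℕ} {a c : Fin d → ℝ} {μ : Fin d → Measure ℝ}
    (hμ_supp : ∀ i, μ i (Icc (a i) (c i)) = 1)
    {b : (Fin d → ℝ) → ℝ} (hb : Continuous b) {B : ℝ}
    (hB : ∀ x : Fin d → ℝ, (∀ i, x i ∈ Icc (a i) (c i)) → |b x| ≤ B)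
    {γ : Measure (Fin d → ℝ)} [IsProbabilityMeasure γ] (hγ : ∀ i, γ.map (fun z => z i) = μ i) :
    (γ.map b) (Icc (-B) B) = 1 := by
  rw [Measure.map_apply hb.measurable measurableSet_Icc,
    ← mem_ae_iff_prob_eq_one (hb.measurable measurableSet_Icc)]
  filter_upwards [pi_supp hμ_supp hγ] with x hx using abs_le.1 (hB x hx)

lemma transfer {d : ℕ} {a c : Fin d → ℝ} {μ ν : Fin d → Measure ℝ}
    (hμ_supp : ∀ i, μ i (Icc (a i) (c i)) = 1) (hν_supp : ∀ i, ν i (Icc (a i) (c i)) = 1)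
    {α : ℝ → ℝ} {M : ℝ} (hα_mono : MonotoneOn α (Icc 0 1))
    (hα_nonneg : ∀ m ∈ Icc (0:ℝ) 1, 0 ≤ α m)
    (hα_bdd : ∀ m ∈ Icc (0:ℝ) 1, α m ≤ M)
    {b : (Fin d → ℝ) → ℝ} (hb : Continuous b) {B : ℝ}
    (hB : ∀ x : Fin d → ℝ, (∀ i, x i ∈ Icc (a i) (c i)) → |b x| ≤ B)
    {p K : ℝ} (hp : 1 ≤ p) (hK_nonneg : 0 ≤ K)
    (hb_lip : ∀ x y : Fin d → ℝ, |b x - b y| ≤ K * (∑ i, |x i - y i| ^ p) ^ (1/p))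
    (π : Fin d → Measure (ℝ × ℝ)) (hπ : ∀ i, IsProbabilityMeasure (π i))
    (hfst : ∀ i, (π i).map Prod.fst = μ i) (hsnd : ∀ i, (π i).map Prod.snd = ν i)
    (γ : Measure (Fin d → ℝ)) [IsProbabilityMeasure γ] (hγ : ∀ i, γ.map (fun z => z i) = μ i) :
    ∃ γ' : Measure (Fin d → ℝ),
      (IsProbabilityMeasure γ' ∧ ∀ i, γ'.map (fun z => z i) = ν i) ∧
      |specRisk α (γ.map b) - specRisk α (γ'.map b)| ≤
        M * K * (∑ i, ∫ q : ℝ × ℝ, |q.1 - q.2| ^ p ∂(π i)) ^ (1/p) := by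
  obtain ⟨Y, hY, hYπ⟩ := glue γ π hπ (fun i => (hfst i).trans (hγ i).symm)
  set P := γ.prod (volume : Measure unitInterval) with hP
  have hp0 : 0 < p := by linarith
  have hM : 0 ≤ M := (hα_nonneg 0 (by simp)).trans (hα_bdd 0 (by simp))
  have hYi : ∀ i, Measurable fun ω => Y ω i := fun i => (measurable_pi_apply i).comp hY
  have hXi : ∀ i, Measurable fun ω : (Fin d → ℝ) × unitInterval => ω.1 i :=
    fun i => (measurable_pi_apply i).comp measurable_fst
  have hfstP : P.map Prod.fst = γ := by
    rw [hP, Measure.map_fst_prod]; simp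
  have hγ' : ∀ i, (P.map Y).map (fun z => z i) = ν i := by
    intro i
    rw [Measure.map_map (measurable_pi_apply i) hY, ← hsnd i, ← hYπ i,
      Measure.map_map measurable_snd ((hXi i).prodMk (hYi i))]
    rfl
  have hprob' : IsProbabilityMeasure (P.map Y) := Measure.isProbabilityMeasure_map hY.aemeasurable
  refine ⟨P.map Y, ⟨hprob', hγ'⟩, ?_⟩
  have hXs : ∀ᵐ ω ∂P, ∀ i, ω.1 i ∈ Icc (a i) (c i) := by
    have := pi_supp hμ_supp hγ
    rw [← hfstP] at this
    exact ae_of_ae_map measurable_fst.aemeasurable this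
  have hYs : ∀ᵐ ω ∂P, ∀ i, Y ω i ∈ Icc (a i) (c i) :=
    ae_of_ae_map hY.aemeasurable (pi_supp hν_supp hγ')
  have e1 : γ.map b = P.map (fun ω => b ω.1) := by
    rw [← hfstP, Measure.map_map hb.measurable measurable_fst]; rfl
  have e2 : (P.map Y).map b = P.map (fun ω => b (Y ω)) := by
    rw [Measure.map_map hb.measurable hY]; rfl
  have hUB := map_supp hμ_supp hb hB hγ
  have hVB := map_supp hν_supp hb hB hγ'
  have hUm : Measurable fun ω : (Fin d → ℝ) × unitInterval => b ω.1 :=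
    hb.measurable.comp measurable_fst
  have hVm : Measurable fun ω => b (Y ω) := hb.measurable.comp hY
  have hint : Integrable (fun ω => |b ω.1 - b (Y ω)|) P := by
    refine Integrable.of_bound (C := B + B) (hUm.sub hVm).abs.aestronglyMeasurable ?_
    filter_upwards [hXs, hYs] with ω h1 h2
    rw [Real.norm_eq_abs, abs_abs]
    exact (abs_sub _ _).trans (add_le_add (hB _ h1) (hB _ h2))
  have hDm : ∀ i, Measurable fun ω : (Fin d → ℝ) × unitInterval => |ω.1 i - Y ω i| ^ p :=
    fun i => ((hXi i).sub (hYi i)).abs.pow_const p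
  have hDi : ∀ i, Integrable (fun ω => |ω.1 i - Y ω i| ^ p) P := by
    intro i
    refine Integrable.of_bound (C := |c i - a i| ^ p) (hDm i).aestronglyMeasurable ?_
    filter_upwards [hXs, hYs] with ω h1 h2
    rw [Real.norm_eq_abs, abs_of_nonneg (Real.rpow_nonneg (abs_nonneg _) _)]
    refine Real.rpow_le_rpow (abs_nonneg _) ?_ hp0.le
    have h1 := h1 i
    have h2 := h2 i
    refine le_trans ?_ (le_abs_self _)
    rw [abs_le]
    constructor <;> linarith [h1.1, h1.2, h2.1, h2.2]
  have hS0 : ∀ ω : (Fin d → ℝ) × unitInterval, 0 ≤ ∑ i, |ω.1 i - Y ω i| ^ p := fun ω =>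
    Finset.sum_nonneg fun i _ => Real.rpow_nonneg (abs_nonneg _) _
  have hSi : Integrable (fun ω => ∑ i, |ω.1 i - Y ω i| ^ p) P :=
    integrable_finset_sum _ fun i _ => hDi i
  have hinv : 1 / p ≤ 1 := by rw [div_le_one hp0]; exact hp
  have hinv0 : 0 ≤ 1 / p := by positivity
  have hRi : Integrable ((fun s : ℝ => s ^ (1/p)) ∘ fun ω => ∑ i, |ω.1 i - Y ω i| ^ p) P := by
    refine Integrable.mono' (g := fun ω => 1 + ∑ i, |ω.1 i - Y ω i| ^ p)
      ((integrable_const 1).add hSi) ?_ (ae_of_all _ fun ω => ?_)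
    · exact ((Finset.measurable_fun_sum _ fun i _ => hDm i).pow_const (1/p)).aestronglyMeasurable
    · simp only [Function.comp]
      have h0 := hS0 ω
      rw [Real.norm_eq_abs, abs_of_nonneg (Real.rpow_nonneg h0 _)]
      rcases le_total (∑ i, |ω.1 i - Y ω i| ^ p) 1 with h | h
      · linarith [Real.rpow_le_one h0 h hinv0]
      · have := Real.rpow_le_rpow_of_exponent_le h hinv
        rw [Real.rpow_one] at this
        linarith
  have hJ := ConcaveOn.le_map_integral (μ := P) (Real.concaveOn_rpow hinv0 hinv)
    (Real.continuous_rpow_const hinv0).continuousOn isClosed_Ici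
    (ae_of_all _ fun ω => hS0 ω) hSi hRi
  have hsum : ∫ ω, ∑ i, |ω.1 i - Y ω i| ^ p ∂P = ∑ i, ∫ q : ℝ × ℝ, |q.1 - q.2| ^ p ∂(π i) := by
    rw [integral_finset_sum _ fun i _ => hDi i]
    refine Finset.sum_congr rfl fun i _ => ?_
    rw [← hYπ i, integral_map ((hXi i).prodMk (hYi i)).aemeasurable]
    exact ((measurable_fst.sub measurable_snd).abs.pow_const p).aestronglyMeasurable
  rw [hsum] at hJ
  rw [e1] at hUB ⊢
  rw [e2] at hVB ⊢
  refine (specRisk_diff P _ _ hUm hVm B M α hα_mono hα_nonneg hα_bdd hUB hVB hint).trans ?_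
  rw [mul_assoc]
  refine mul_le_mul_of_nonneg_left ?_ hM
  calc ∫ ω, |b ω.1 - b (Y ω)| ∂P ≤ ∫ ω, K * (∑ i, |ω.1 i - Y ω i| ^ p) ^ (1/p) ∂P :=
        integral_mono hint (hRi.const_mul K) fun ω => hb_lip _ _
    _ = K * ∫ ω, (∑ i, |ω.1 i - Y ω i| ^ p) ^ (1/p) ∂P := integral_const_mul _ _
    _ ≤ _ := mul_le_mul_of_nonneg_left hJ hK_nonneg

lemma Wp_comm (p : ℝ) (μ ν : Measure ℝ) : Wp p μ ν = Wp p ν μ := by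
  have key : ∀ μ ν : Measure ℝ, ∀ w : ℝ, (∃ π : Measure (ℝ × ℝ), IsProbabilityMeasure π ∧
    π.map Prod.fst = μ ∧ π.map Prod.snd = ν ∧
    w = (∫ q : ℝ × ℝ, |q.1 - q.2| ^ p ∂π) ^ (1/p)) → (∃ π : Measure (ℝ × ℝ),
    IsProbabilityMeasure π ∧ π.map Prod.fst = ν ∧ π.map Prod.snd = μ ∧
    w = (∫ q : ℝ × ℝ, |q.1 - q.2| ^ p ∂π) ^ (1/p)) := by
    rintro μ ν w ⟨π, h0, h1, h2, h3⟩
    refine ⟨π.map Prod.swap, Measure.isProbabilityMeasure_map measurable_swap.aemeasurable,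
      ?_, ?_, ?_⟩
    · rw [Measure.map_map measurable_fst measurable_swap]; exact h2
    · rw [Measure.map_map measurable_snd measurable_swap]; exact h1
    · rw [h3, integral_map measurable_swap.aemeasurable]
      · simp only [Prod.fst_swap, Prod.snd_swap, abs_sub_comm]
      · exact ((measurable_fst.sub measurable_snd).abs.pow_const p).aestronglyMeasurable
  unfold Wp
  congr 1
  ext w
  exact ⟨key _ _ w, key _ _ w⟩

lemma exists_coupling {p : ℝ} (hp : 1 ≤ p) (μ ν : Measure ℝ) [IsProbabilityMeasure μ]
    [IsProbabilityMeasure ν] {ε : ℝ} (hε : 0 < ε) :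
    0 ≤ Wp p μ ν ∧ ∃ π : Measure (ℝ × ℝ), IsProbabilityMeasure π ∧
    π.map Prod.fst = μ ∧ π.map Prod.snd = ν ∧
    ∫ q : ℝ × ℝ, |q.1 - q.2| ^ p ∂π ≤ (Wp p μ ν + ε) ^ p := by
  have hp0 : 0 < p := by linarith
  have hn : ∀ π : Measure (ℝ × ℝ), 0 ≤ ∫ q : ℝ × ℝ, |q.1 - q.2| ^ p ∂π := fun π =>
    integral_nonneg fun q => Real.rpow_nonneg (abs_nonneg _) _
  constructor
  · refine Real.sInf_nonneg ?_
    rintro w ⟨π, -, -, -, rfl⟩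
    exact Real.rpow_nonneg (hn π) _
  · have hne : {w : ℝ | ∃ π : Measure (ℝ × ℝ), IsProbabilityMeasure π ∧
      π.map Prod.fst = μ ∧ π.map Prod.snd = ν ∧
      w = (∫ q : ℝ × ℝ, |q.1 - q.2| ^ p ∂π) ^ (1/p)}.Nonempty :=
      ⟨_, μ.prod ν, inferInstance, by rw [Measure.map_fst_prod]; simp,
        by rw [Measure.map_snd_prod]; simp, rfl⟩
    obtain ⟨w, ⟨π, h0, h1, h2, h3⟩, hw⟩ := Real.lt_sInf_add_pos hne hε
    refine ⟨π, h0, h1, h2, ?_⟩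
    have hw' : w ≤ Wp p μ ν + ε := hw.le
    have : w ^ p ≤ (Wp p μ ν + ε) ^ p :=
      Real.rpow_le_rpow (h3 ▸ Real.rpow_nonneg (hn π) _) hw' hp0.le
    rwa [h3, ← Real.rpow_mul (hn π), one_div, inv_mul_cancel₀ hp0.ne', Real.rpow_one] at this

lemma half {d : ℕ} {a c : Fin d → ℝ} {μ ν : Fin d → Measure ℝ}
    (hμ_prob : ∀ i, IsProbabilityMeasure (μ i)) (hν_prob : ∀ i, IsProbabilityMeasure (ν i))
    (hμ_supp : ∀ i, μ i (Icc (a i) (c i)) = 1) (hν_supp : ∀ i, ν i (Icc (a i) (c i)) = 1)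
    {α : ℝ → ℝ} {M : ℝ} (hα_mono : MonotoneOn α (Icc 0 1))
    (hα_nonneg : ∀ m ∈ Icc (0:ℝ) 1, 0 ≤ α m)
    (hα_bdd : ∀ m ∈ Icc (0:ℝ) 1, α m ≤ M)
    {b : (Fin d → ℝ) → ℝ} (hb : Continuous b) {B : ℝ}
    (hB : ∀ x : Fin d → ℝ, (∀ i, x i ∈ Icc (a i) (c i)) → |b x| ≤ B)
    {p K : ℝ} (hp : 1 ≤ p) (hK_nonneg : 0 ≤ K)
    (hb_lip : ∀ x y : Fin d → ℝ, |b x - b y| ≤ K * (∑ i, |x i - y i| ^ p) ^ (1/p)) :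
    sSup {r : ℝ | ∃ γ : Measure (Fin d → ℝ),
        (IsProbabilityMeasure γ ∧ ∀ i, γ.map (fun z => z i) = μ i) ∧
        r = specRisk α (γ.map b)} -
      sSup {r : ℝ | ∃ γ : Measure (Fin d → ℝ),
        (IsProbabilityMeasure γ ∧ ∀ i, γ.map (fun z => z i) = ν i) ∧
        r = specRisk α (γ.map b)} ≤
    M * K * (∑ i, Wp p (μ i) (ν i) ^ p) ^ (1/p) := by
  have hp0 : 0 < p := by linarith
  have hM : 0 ≤ M := (hα_nonneg 0 (by simp)).trans (hα_bdd 0 (by simp))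
  rw [sub_le_iff_le_add']
  refine csSup_le ?_ ?_
  · refine ⟨_, Measure.pi μ, ⟨inferInstance, fun i => ?_⟩, rfl⟩
    exact (measurePreserving_eval μ i).map_eq
  rintro r ⟨γ, ⟨hγp, hγ⟩, rfl⟩
  rw [← sub_le_iff_le_add']
  have hlim : Tendsto (fun ε : ℝ => M * K * (∑ i, (Wp p (μ i) (ν i) + ε) ^ p) ^ (1/p))
      (𝓝[>] 0) (𝓝 (M * K * (∑ i, Wp p (μ i) (ν i) ^ p) ^ (1/p))) := by
    have hc : Continuous (fun ε : ℝ => M * K * (∑ i, (Wp p (μ i) (ν i) + ε) ^ p) ^ (1/p)) := by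
      refine continuous_const.mul ?_
      refine (Real.continuous_rpow_const (by positivity)).comp ?_
      refine continuous_finset_sum _ fun i _ => ?_
      exact (Real.continuous_rpow_const hp0.le).comp (by fun_prop)
    have := (hc.tendsto 0).mono_left (nhdsWithin_le_nhds (s := Ioi 0))
    simpa only [add_zero] using this
  refine ge_of_tendsto hlim (eventually_nhdsWithin_of_forall fun ε hε => ?_)
  choose hW π h0 h1 h2 h3 using fun i => exists_coupling hp (μ i) (ν i) (ε := ε) hε
  obtain ⟨γ', hγ', hle⟩ := transfer hμ_supp hν_supp hα_mono hα_nonneg hα_bdd hb hB hp hK_nonneg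
    hb_lip π h0 h1 h2 γ hγ
  have hbdd : BddAbove {r : ℝ | ∃ γ : Measure (Fin d → ℝ),
        (IsProbabilityMeasure γ ∧ ∀ i, γ.map (fun z => z i) = ν i) ∧
        r = specRisk α (γ.map b)} := by
    refine ⟨B * M, ?_⟩
    rintro r ⟨η, ⟨hηp, hη⟩, rfl⟩
    have := Measure.isProbabilityMeasure_map (μ := η) hb.measurable.aemeasurable
    exact (le_abs_self _).trans (specRisk_bound hα_nonneg hα_bdd (map_supp hν_supp hb hB hη))
  have hle2 := le_csSup hbdd ⟨γ', hγ', rfl⟩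
  have hmono : M * K * (∑ i, ∫ q : ℝ × ℝ, |q.1 - q.2| ^ p ∂(π i)) ^ (1/p) ≤
      M * K * (∑ i, (Wp p (μ i) (ν i) + ε) ^ p) ^ (1/p) := by
    refine mul_le_mul_of_nonneg_left ?_ (mul_nonneg hM hK_nonneg)
    refine Real.rpow_le_rpow (Finset.sum_nonneg fun i _ => integral_nonneg fun q =>
      Real.rpow_nonneg (abs_nonneg _) _) (Finset.sum_le_sum fun i _ => h3 i) (by positivity)
  have := (le_abs_self _).trans hle
  linarith

/-- for a weakly compatible `b` (increasing in the `Splus` variables,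
decreasing in the others) which is `K`-Lipschitz for the `ℓ^p` norm, and `α ≤ M`, the
maximal spectral risk is Lipschitz in the marginals:
`|max_Γ(μ) R_α(b_#·) - max_Γ(ν) R_α(b_#·)| ≤ M K (Σ_i W_p(μ_i,ν_i)^p)^{1/p}`. -/
theorem stmt15 (d : ℕ) (a c : Fin d → ℝ) (hac : ∀ i, a i ≤ c i)
    (μ ν : Fin d → Measure ℝ)
    (hμ_prob : ∀ i, IsProbabilityMeasure (μ i)) (hν_prob : ∀ i, IsProbabilityMeasure (ν i))
    (hμ_supp : ∀ i, μ i (Icc (a i) (c i)) = 1) (hν_supp : ∀ i, ν i (Icc (a i) (c i)) = 1)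
    (α : ℝ → ℝ) (M : ℝ) (hα_mono : MonotoneOn α (Icc 0 1))
    (hα_nonneg : ∀ m ∈ Icc (0:ℝ) 1, 0 ≤ α m)
    (hα_bdd : ∀ m ∈ Icc (0:ℝ) 1, α m ≤ M)
    (b : (Fin d → ℝ) → ℝ) (hb : ContDiff ℝ 2 b)
    (Kset : Set (Fin d → ℝ)) (hK : Kset = {x | ∀ i, x i ∈ Icc (a i) (c i)})
    (Splus : Set (Fin d))
    (hsign_same : ∀ i j, i ≠ j → ((i ∈ Splus ∧ j ∈ Splus) ∨ (i ∉ Splus ∧ j ∉ Splus)) →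
      ∀ x ∈ Kset, 0 ≤ partial2 b i j x)
    (hsign_diff : ∀ i j, i ≠ j → ¬((i ∈ Splus ∧ j ∈ Splus) ∨ (i ∉ Splus ∧ j ∉ Splus)) →
      ∀ x ∈ Kset, partial2 b i j x ≤ 0)
    (hcompat : ∀ i j k : Fin d, i ≠ j → j ≠ k → i ≠ k →
      ∀ x ∈ Kset, 0 ≤ partial2 b i j x * partial2 b k j x * partial2 b k i x)
    (hmono_plus : ∀ i ∈ Splus, ∀ x ∈ Kset, ∀ t ∈ Icc (a i) (c i), ∀ t' ∈ Icc (a i) (c i),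
      t ≤ t' → b (Function.update x i t) ≤ b (Function.update x i t'))
    (hmono_minus : ∀ i ∉ Splus, ∀ x ∈ Kset, ∀ t ∈ Icc (a i) (c i), ∀ t' ∈ Icc (a i) (c i),
      t ≤ t' → b (Function.update x i t') ≤ b (Function.update x i t))
    (p K : ℝ) (hp : 1 ≤ p) (hK_nonneg : 0 ≤ K)
    (hb_lip : ∀ x y : Fin d → ℝ, |b x - b y| ≤ K * (∑ i, |x i - y i| ^ p) ^ (1/p)) :
    |sSup {r : ℝ | ∃ γ : Measure (Fin d → ℝ),
        (IsProbabilityMeasure γ ∧ ∀ i, γ.map (fun z => z i) = μ i) ∧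
        r = specRisk α (γ.map b)} -
      sSup {r : ℝ | ∃ γ : Measure (Fin d → ℝ),
        (IsProbabilityMeasure γ ∧ ∀ i, γ.map (fun z => z i) = ν i) ∧
        r = specRisk α (γ.map b)}| ≤
    M * K * (∑ i, Wp p (μ i) (ν i) ^ p) ^ (1/p) := by

  have hbc : Continuous b := hb.continuous
  have hcomp : IsCompact (Set.pi univ fun i => Icc (a i) (c i)) :=
    isCompact_univ_pi fun i => isCompact_Icc
  obtain ⟨B, hB'⟩ := hcomp.exists_bound_of_continuousOn hbc.continuousOn
  have hB : ∀ x : Fin d → ℝ, (∀ i, x i ∈ Icc (a i) (c i)) → |b x| ≤ B :=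
    fun x hx => hB' x (fun i _ => hx i)
  rw [abs_sub_le_iff]
  constructor
  · exact half hμ_prob hν_prob hμ_supp hν_supp hα_mono hα_nonneg hα_bdd hbc hB hp hK_nonneg hb_lip
  · simp only [fun i => Wp_comm p (μ i) (ν i)]
    exact half hν_prob hμ_prob hν_supp hμ_supp hα_mono hα_nonneg hα_bdd hbc hB hp hK_nonneg hb_lip
end
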